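/- Let λ > 0 and c > 0 be real numbers. Let X be a real-valued random variable that is exponentially distributed with rate 2λ (i.e., X has probability density function t ↦ 2λ·e^{-2λt} on [0,∞)). Then the random variable Y = √(X² + c²) has probability density function (with respect to Lebesgue measure) given by f(r) = (2λr/√(r² − c²))·e^{-2λ√(r² − c²)} for r > c and f(r) = 0 for r ≤ c. -/

import Mathlib

open MeasureTheory ProbabilityTheory Real

lemma hasDerivAt_sqrt_sq_sub_sq {c r : ℝ} (hr : 0 < r ^ 2 - c ^ 2) :
    HasDerivAt (fun r => √(r ^ 2 - c ^ 2)) (r / √(r ^ 2 - c ^ 2)) r := by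
  have h : HasDerivAt (fun r : ℝ => r ^ 2 - c ^ 2) (2 * r) r := by
    simpa using (hasDerivAt_pow 2 r).sub_const (c ^ 2)
  convert h.sqrt hr.ne' using 1
  rw [mul_div_mul_left _ _ two_ne_zero]

lemma image_sqrt_sq_sub_sq_Ioi {c : ℝ} (hc : 0 ≤ c) :
    (fun r => √(r ^ 2 - c ^ 2)) '' Set.Ioi c = Set.Ioi 0 := by
  ext t
  simp only [Set.mem_image, Set.mem_Ioi]
  constructor
  · rintro ⟨r, hr, rfl⟩
    exact Real.sqrt_pos.2 (by nlinarith)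
  · intro ht
    refine ⟨√(t ^ 2 + c ^ 2), Real.lt_sqrt_of_sq_lt (by nlinarith), ?_⟩
    rw [Real.sq_sqrt (by positivity), add_sub_cancel_right, Real.sqrt_sq ht.le]

lemma sqrt_sqrt_sq_sub_sq_sq_add_sq {c r : ℝ} (hc : 0 ≤ c) (hr : c ≤ r) :
    √(√(r ^ 2 - c ^ 2) ^ 2 + c ^ 2) = r := by
  rw [Real.sq_sqrt (by nlinarith), sub_add_cancel, Real.sqrt_sq (hc.trans hr)]

lemma lintegral_Ioi_zero_eq_lintegral_Ioi_sqrt_sq_sub_sq {c : ℝ} (hc : 0 ≤ c)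
    (g : ℝ → ENNReal) :
    ∫⁻ t in Set.Ioi 0, g t =
      ∫⁻ r in Set.Ioi c, ENNReal.ofReal (r / √(r ^ 2 - c ^ 2)) * g √(r ^ 2 - c ^ 2) := by
  have hinj : Set.InjOn (fun r => √(r ^ 2 - c ^ 2)) (Set.Ioi c) :=
    Set.LeftInvOn.injOn (f₁' := fun t => √(t ^ 2 + c ^ 2))
      fun r hr => sqrt_sqrt_sq_sub_sq_sq_add_sq hc (le_of_lt hr)
  rw [← image_sqrt_sq_sub_sq_Ioi hc, lintegral_image_eq_lintegral_abs_deriv_mul measurableSet_Ioi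
    (fun r hr => (hasDerivAt_sqrt_sq_sub_sq
      (by rw [Set.mem_Ioi] at hr; nlinarith)).hasDerivWithinAt) hinj]
  refine setLIntegral_congr_fun measurableSet_Ioi fun r hr => ?_
  have hr0 : 0 ≤ r := hc.trans (le_of_lt hr)
  rw [abs_of_nonneg (by positivity)]

lemma lintegral_expMeasure (rate : ℝ) {g : ℝ → ENNReal} (hg : Measurable g) :
    ∫⁻ t, g t ∂expMeasure rate =
      ∫⁻ t in Set.Ioi 0, ENNReal.ofReal (rate * Real.exp (-(rate * t))) * g t := by
  have hm : Measurable (exponentialPDF rate) :=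
    (measurable_exponentialPDFReal rate).ennreal_ofReal
  change ∫⁻ t, g t ∂(volume.withDensity (exponentialPDF rate)) = _
  rw [lintegral_withDensity_eq_lintegral_mul _ hm hg, ← setLIntegral_congr Ioi_ae_eq_Ici.symm,
    ← lintegral_indicator measurableSet_Ici]
  refine lintegral_congr fun t => ?_
  by_cases ht : 0 ≤ t
  · simp [ht, exponentialPDF_of_nonneg]
  · simp [ht, exponentialPDF_of_neg (not_le.1 ht)]

/-- Lemma 1 of the paper: if `X` is exponentially distributed with rate `2λ`, the random
variable `Y = √(X² + c²)` has density
`r ↦ (2λ r / √(r² − c²)) · exp (−2λ √(r² − c²))` for `r > c` and `0` for `r ≤ c`. -/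
theorem closest_bs_distance_pdf
    {Ω : Type*} [MeasureSpace Ω] [IsProbabilityMeasure (ℙ : Measure Ω)]
    (lam c : ℝ) (hlam : 0 < lam) (hc : 0 < c)
    (X : Ω → ℝ) (hX : Measurable X)
    (hXexp : Measure.map X ℙ = expMeasure (2 * lam)) :
    Measure.map (fun ω => Real.sqrt ((X ω) ^ 2 + c ^ 2)) ℙ =
      volume.withDensity (fun r => ENNReal.ofReal
        (if c < r then
          (2 * lam * r / Real.sqrt (r ^ 2 - c ^ 2)) *
            Real.exp (-(2 * lam) * Real.sqrt (r ^ 2 - c ^ 2))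
         else 0)) := by
  have hY : Measurable fun t : ℝ => √(t ^ 2 + c ^ 2) := by fun_prop
  ext A hA
  have hone : Measurable (A.indicator (1 : ℝ → ENNReal)) := measurable_one.indicator hA
  rw [← Function.comp_def (fun t : ℝ => √(t ^ 2 + c ^ 2)) X, ← Measure.map_map hY hX, hXexp,
    ← lintegral_indicator_one hA, lintegral_map hone hY,
    lintegral_expMeasure (g := fun t => A.indicator 1 √(t ^ 2 + c ^ 2)) _ (hone.comp hY),
    lintegral_Ioi_zero_eq_lintegral_Ioi_sqrt_sq_sub_sq hc.le, withDensity_apply _ hA,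
    ← lintegral_indicator measurableSet_Ioi, ← lintegral_indicator hA]
  refine lintegral_congr fun r => ?_
  by_cases hr : c < r
  · have hr0 : 0 < r := hc.trans hr
    rw [Set.indicator_of_mem (Set.mem_Ioi.2 hr), sqrt_sqrt_sq_sub_sq_sq_add_sq hc.le hr.le]
    by_cases hrA : r ∈ A
    · rw [Set.indicator_of_mem hrA, Set.indicator_of_mem hrA, if_pos hr, Pi.one_apply, mul_one,
        ← ENNReal.ofReal_mul (by positivity)]
      ring_nf
    · simp [hrA]
  · simp [hr, Set.indicator]
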